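/- For every integer n > 1, there exists a threshold τ_+(n) < ∞ such that for every τ > τ_+(n), the function f_{n,τ}(x) = (x+1)·log( n − x − 1 + e^{1/τ} + x·e^{−1/(τx)} ) is strictly convex on the interval [1, n−1]. -/

import Mathlib

/-- The function `f_{n,τ}(x) = (x+1)·log( n − x − 1 + e^{1/τ} + x·e^{−1/(τx)} )`. -/
noncomputable def fnt (n : ℕ) (τ : ℝ) (x : ℝ) : ℝ :=
  (x + 1) * Real.log ((n : ℝ) - x - 1 + Real.exp (1 / τ) + x * Real.exp (-1 / (τ * x)))

lemma one_sub_sq_div_two_le_exp_neg_mul {u : ℝ} (h0 : 0 ≤ u) (h1 : u ≤ 1) :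
    1 - u ^ 2 / 2 ≤ Real.exp (-u) * (1 + u) := by
  have h := Real.exp_bound' h0 h1 (n := 3) (by norm_num)
  norm_num [Finset.sum_range_succ, Nat.factorial] at h
  rw [Real.exp_neg, inv_mul_eq_div, le_div_iff₀ (Real.exp_pos u)]
  have h2 : 0 ≤ 1 - u ^ 2 / 2 := by nlinarith
  have h3 := mul_le_mul_of_nonneg_left h h2
  nlinarith [pow_nonneg h0 3, pow_nonneg h0 4, pow_nonneg h0 5]

lemma exp_neg_mul_one_add_le_one (u : ℝ) : Real.exp (-u) * (1 + u) ≤ 1 := by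
  rw [Real.exp_neg, inv_mul_eq_div, div_le_one (Real.exp_pos u)]
  linarith [Real.add_one_le_exp u]

/-- The argument of the logarithm in `fnt`, in terms of the inverse temperature `t = 1 / τ`. -/
noncomputable def logArg (n : ℕ) (t x : ℝ) : ℝ :=
  (n : ℝ) - x - 1 + Real.exp t + x * Real.exp (-(t / x))

lemma fnt_eq_mul_log_logArg (n : ℕ) (τ : ℝ) :
    fnt n τ = fun x => (x + 1) * Real.log (logArg n (1 / τ) x) := by
  funext x
  rw [fnt, logArg, div_div, neg_div]

lemma le_logArg (n : ℕ) (t : ℝ) {x : ℝ} (hx : 0 < x) : (n : ℝ) ≤ logArg n t x := by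
  have h1 := Real.add_one_le_exp t
  have h2 := mul_le_mul_of_nonneg_left (Real.add_one_le_exp (-(t / x))) hx.le
  have h3 : x * (t / x) = t := by field_simp
  unfold logArg
  nlinarith

lemma hasDerivAt_exp_neg_div (t : ℝ) {x : ℝ} (hx : x ≠ 0) :
    HasDerivAt (fun y => Real.exp (-(t / y))) (Real.exp (-(t / x)) * (t / x ^ 2)) x := by
  have h := ((hasDerivAt_inv hx).const_mul t).neg.exp
  refine HasDerivAt.congr_deriv h ?_
  simp only [Pi.neg_apply, ← div_eq_mul_inv]
  ring

lemma hasDerivAt_logArg (n : ℕ) (t : ℝ) {x : ℝ} (hx : x ≠ 0) :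
    HasDerivAt (logArg n t) (Real.exp (-(t / x)) * (1 + t / x) - 1) x := by
  have h := ((((hasDerivAt_id x).const_sub (n : ℝ)).sub_const 1).add_const (Real.exp t)).add
    ((hasDerivAt_id x).mul (hasDerivAt_exp_neg_div t hx))
  refine HasDerivAt.congr_deriv h ?_
  simp only [id]
  field_simp
  ring

lemma hasDerivAt_deriv_logArg (t : ℝ) {x : ℝ} (hx : x ≠ 0) :
    HasDerivAt (fun y => Real.exp (-(t / y)) * (1 + t / y) - 1)
      (Real.exp (-(t / x)) * (t / x) ^ 2 / x) x := by
  have h := ((hasDerivAt_exp_neg_div t hx).mul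
    (((hasDerivAt_inv hx).const_mul t).const_add 1)).sub_const 1
  refine HasDerivAt.congr_deriv h ?_
  simp only [← div_eq_mul_inv]
  field_simp
  ring

lemma hasDerivAt_mul_log {g : ℝ → ℝ} {g' x : ℝ} (hg : HasDerivAt g g' x) (h0 : g x ≠ 0) :
    HasDerivAt (fun y => (y + 1) * Real.log (g y)) (Real.log (g x) + (x + 1) * (g' / g x)) x := by
  have h := ((hasDerivAt_id x).add_const 1).mul (hg.log h0)
  refine HasDerivAt.congr_deriv h ?_
  simp only [id, one_mul]

lemma deriv2_mul_log {g g' : ℝ → ℝ} {g'' x : ℝ} (hg : ∀ᶠ y in nhds x, HasDerivAt g (g' y) y)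
    (hg' : HasDerivAt g' g'' x) (h0 : g x ≠ 0) :
    deriv^[2] (fun y => (y + 1) * Real.log (g y)) x =
      (2 * g' x + (x + 1) * (g'' - g' x ^ 2 / g x)) / g x := by
  have hgx := hg.self_of_nhds
  have he : deriv (fun y => (y + 1) * Real.log (g y)) =ᶠ[nhds x]
      fun y => Real.log (g y) + (y + 1) * (g' y / g y) := by
    filter_upwards [hg, hgx.continuousAt.eventually_ne h0] with y hy hy0
    exact (hasDerivAt_mul_log hy hy0).deriv
  have h := (hgx.log h0).add (((hasDerivAt_id x).add_const 1).mul (hg'.div hgx h0))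
  simp only [Function.iterate_succ, Function.iterate_zero, Function.comp, id]
  rw [he.deriv_eq]
  refine (HasDerivAt.congr_deriv h ?_).deriv
  simp only [id, Pi.div_apply]
  field_simp
  ring

lemma second_deriv_numerator_pos {t x g : ℝ} (ht : 0 < t) (ht' : t < 1 / 4) (hx : 1 ≤ x)
    (hg : x + 1 ≤ g) :
    0 < 2 * (Real.exp (-(t / x)) * (1 + t / x) - 1) +
      (x + 1) * (Real.exp (-(t / x)) * (t / x) ^ 2 / x -
        (Real.exp (-(t / x)) * (1 + t / x) - 1) ^ 2 / g) := by
  have hx0 : 0 < x := by linarith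
  set u := t / x with hu
  have hxu : t = u * x := by rw [hu]; field_simp
  have hu0 : 0 < u := by positivity
  have hut : u ≤ t := div_le_self ht.le hx
  have hlow := one_sub_sq_div_two_le_exp_neg_mul hu0.le (by linarith)
  have hup := exp_neg_mul_one_add_le_one u
  have hexp := Real.add_one_le_exp (-u)
  set d := Real.exp (-u) * (1 + u) - 1 with hd
  have hdsq : d ^ 2 ≤ (u ^ 2 / 2) ^ 2 := by
    exact sq_le_sq' (by linarith) (by nlinarith)
  have hquot : (x + 1) * (d ^ 2 / g) ≤ u ^ 4 / 4 := by
    rw [← mul_div_assoc, div_le_iff₀ (by linarith)]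
    nlinarith [sq_nonneg d, sq_nonneg (u ^ 2)]
  have hsecond : (x + 1) * ((1 - u) * u ^ 2 / x) ≤ (x + 1) * (Real.exp (-u) * u ^ 2 / x) := by
    gcongr
    linarith
  have hmain : 0 < -u ^ 2 + (x + 1) * ((1 - u) * u ^ 2 / x) - u ^ 4 / 4 := by
    have : -u ^ 2 + (x + 1) * ((1 - u) * u ^ 2 / x) - u ^ 4 / 4 =
        u ^ 2 / x * (1 - u - t - t * u / 4) := by
      rw [hxu]
      field_simp
      ring
    rw [this]
    have : 0 < 1 - u - t - t * u / 4 := by nlinarith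
    positivity
  linarith

theorem stmt11 (n : ℕ) (hn : 1 < n) :
    ∃ τp : ℝ, 0 < τp ∧ ∀ τ : ℝ, τp < τ →
      StrictConvexOn ℝ (Set.Icc (1 : ℝ) ((n : ℝ) - 1)) (fnt n τ) := by
  refine ⟨4, by norm_num, fun τ hτ => ?_⟩
  have ht : 0 < 1 / τ := by positivity
  have ht' : 1 / τ < 1 / 4 := one_div_lt_one_div_of_lt (by norm_num) hτ
  have hn0 : (0 : ℝ) < n := by positivity
  rw [fnt_eq_mul_log_logArg]
  refine strictConvexOn_of_deriv2_pos (convex_Icc _ _) (fun x hx => ?_) (fun x hx => ?_)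
  · have hx0 : 0 < x := by linarith [hx.1]
    exact (hasDerivAt_mul_log (hasDerivAt_logArg n _ hx0.ne')
      (hn0.trans_le (le_logArg n _ hx0)).ne').continuousAt.continuousWithinAt
  · rw [interior_Icc] at hx
    have hx0 : 0 < x := by linarith [hx.1]
    have hle := le_logArg n (1 / τ) hx0
    have hg0 := hn0.trans_le hle
    rw [deriv2_mul_log ((eventually_ne_nhds hx0.ne').mono fun y hy => hasDerivAt_logArg n _ hy)
      (hasDerivAt_deriv_logArg _ hx0.ne') hg0.ne']
    exact div_pos (second_deriv_numerator_pos ht ht' hx.1.le (by linarith [hx.2])) hg0
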